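/- Let p > 1 and k > 0 be real, let V : (0,∞) → ℝ satisfy 0 < V(x) < 1 and ((1+V(x)²)/(1−V(x)²))^(p−1) · x² · V(x) = k for all x > 0, and suppose V has derivative v at some point x₀ > 0 (HasDerivAt V v x₀). Then v · ( 4(p−1)·V(x₀)/(1 − V(x₀)⁴) + 1/V(x₀) ) = −2/x₀; in particular v < 0. -/

import Mathlib

/-- For real `p > 1`, `k > 0`, if `V` satisfies `0 < V x < 1` and
`((1 + V x²)/(1 − V x²))^(p−1) · x² · V x = k` for all `x > 0` (real power `Real.rpow`),
and `V` has derivative `v` at some `x₀ > 0`, then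
`v · (4(p−1)·V x₀/(1 − V x₀⁴) + 1/V x₀) = −2/x₀`; in particular `v < 0`. -/
theorem deriv_V_eq (p k : ℝ) (hp : 1 < p) (hk : 0 < k) (V : ℝ → ℝ)
    (hV : ∀ x > (0 : ℝ), 0 < V x ∧ V x < 1)
    (heq : ∀ x > (0 : ℝ), ((1 + V x ^ 2) / (1 - V x ^ 2)) ^ (p - 1) * x ^ 2 * V x = k)
    (x₀ v : ℝ) (hx₀ : 0 < x₀) (hd : HasDerivAt V v x₀) :
    v * (4 * (p - 1) * V x₀ / (1 - V x₀ ^ 4) + 1 / V x₀) = -2 / x₀ ∧ v < 0 := by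
  obtain ⟨h0, h1⟩ := hV x₀ hx₀
  have hsq : V x₀ ^ 2 < 1 := by nlinarith
  have hm : 0 < 1 - V x₀ ^ 2 := by linarith
  have hpl : 0 < 1 + V x₀ ^ 2 := by positivity
  have h4 : 1 - V x₀ ^ 4 = (1 - V x₀ ^ 2) * (1 + V x₀ ^ 2) := by ring
  have h4p : 0 < 1 - V x₀ ^ 4 := by rw [h4]; positivity
  have hlog : ∀ x > (0 : ℝ), (p - 1) * (Real.log (1 + V x ^ 2) - Real.log (1 - V x ^ 2))
      + 2 * Real.log x + Real.log (V x) = Real.log k := by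
    intro x hx
    obtain ⟨g0, g1⟩ := hV x hx
    have gm : 0 < 1 - V x ^ 2 := by nlinarith
    have gp : 0 < 1 + V x ^ 2 := by positivity
    have gq : 0 < (1 + V x ^ 2) / (1 - V x ^ 2) := by positivity
    have gr := Real.rpow_pos_of_pos gq (p - 1)
    rw [← heq x hx, Real.log_mul (by positivity) g0.ne', Real.log_mul gr.ne' (by positivity),
      Real.log_rpow gq, Real.log_div gp.ne' gm.ne', Real.log_pow]
    push_cast
    ring
  have hd2 := hd.pow 2
  have e1 := (hd2.const_add 1).log hpl.ne'
  have e2 := (hd2.const_sub 1).log hm.ne'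
  have e3 := (Real.hasDerivAt_log hx₀.ne').const_mul 2
  have e4 := hd.log h0.ne'
  have e := (((e1.sub e2).const_mul (p - 1)).add e3).add e4
  have ec : HasDerivAt (fun _ : ℝ => Real.log k) 0 x₀ := hasDerivAt_const _ _
  have e' := ec.congr_of_eventuallyEq
    (Filter.eventually_of_mem (Ioi_mem_nhds hx₀) fun x hx => hlog x hx)
  have key := e.unique e'
  have main : v * (4 * (p - 1) * V x₀ / (1 - V x₀ ^ 4) + 1 / V x₀) = -2 / x₀ := by
    have : v * (4 * (p - 1) * V x₀ / (1 - V x₀ ^ 4) + 1 / V x₀) + 2 / x₀ = 0 := by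
      rw [← key, h4]
      simp only [Pi.pow_apply]
      field_simp
      push_cast
      ring
    rw [neg_div]
    linarith
  refine ⟨main, ?_⟩
  have hp' : 0 < p - 1 := by linarith
  have hc : 0 < 4 * (p - 1) * V x₀ / (1 - V x₀ ^ 4) + 1 / V x₀ := by positivity
  have hneg : -2 / x₀ < 0 := div_neg_of_neg_of_pos (by norm_num) hx₀
  by_contra hv
  have := mul_nonneg (not_lt.mp hv) hc.le
  linarith
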